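/- The sequence with general term ⌊n³⁰/1116⌋ is eventually prime-free; that is, there exists a natural number N such that for all n ≥ N, ⌊n³⁰/1116⌋ is not prime. -/

import Mathlib

theorem pow_thirty_mod_eight (n : ℕ) : n ^ 30 % 8 = 0 ∨ n ^ 30 % 8 = 1 := by
  have h : n % 8 < 8 := Nat.mod_lt _ (by norm_num)
  rw [Nat.pow_mod]
  interval_cases n % 8 <;> norm_num

theorem pow_thirty_mod_twenty_seven (n : ℕ) : n ^ 30 % 27 = 0 ∨ n ^ 30 % 9 = 1 := by
  have h : n % 27 < 27 := Nat.mod_lt _ (by norm_num)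
  rw [← Nat.mod_mod_of_dvd (n ^ 30) (by norm_num : 9 ∣ 27), Nat.pow_mod]
  interval_cases n % 27 <;> norm_num

theorem pow_thirty_mod_thirty_one (n : ℕ) : n ^ 30 % 31 = 0 ∨ n ^ 30 % 31 = 1 := by
  have h : n % 31 < 31 := Nat.mod_lt _ (by norm_num)
  rw [Nat.pow_mod]
  interval_cases n % 31 <;> norm_num

theorem pow_thirty_div_cases (n : ℕ) :
    2 ∣ n ^ 30 / 1116 ∨ 3 ∣ n ^ 30 / 1116 ∨ n ^ 30 % 1116 = 900 := by
  have h8 := pow_thirty_mod_eight n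
  have h27 := pow_thirty_mod_twenty_seven n
  have h31 := pow_thirty_mod_thirty_one n
  generalize n ^ 30 = x at *
  rcases h8 with h8 | h8 <;> rcases h27 with h27 | h27 <;> rcases h31 with h31 | h31 <;> omega

/-- If `d * p = a ^ 2 - b ^ 2` with `p` prime, then `a - b ≤ d`. -/
theorem le_add_of_sq_eq_mul_prime_add_sq {a b d p : ℕ} (hp : p.Prime) (hd : 0 < d)
    (h : a ^ 2 = d * p + b ^ 2) : a ≤ d + b := by
  by_contra! hlt
  obtain ⟨c, rfl⟩ : ∃ c, a = c + b := ⟨a - b, by omega⟩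
  have hmul : c * (c + 2 * b) = d * p := by nlinarith
  rcases hp.dvd_mul.1 (Dvd.intro_left d hmul.symm) with ⟨k, hk⟩ | ⟨k, hk⟩
  · have h2 : k * (c + 2 * b) = d := by
      apply Nat.eq_of_mul_eq_mul_right hp.pos
      rw [← hmul, hk]; ring
    have : c + 2 * b ≤ d := Nat.le_of_dvd hd (Dvd.intro_left k h2)
    omega
  · have h2 : c * k = d := by
      apply Nat.eq_of_mul_eq_mul_right hp.pos
      rw [← hmul, hk]; ring
    have : c ≤ d := Nat.le_of_dvd hd (Dvd.intro k h2)
    omega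

theorem stmt9 : ∃ N : ℕ, ∀ n : ℕ, N ≤ n → ¬ Nat.Prime (n ^ 30 / 1116) := by
  refine ⟨2, fun n hn hp => ?_⟩
  have hpow : 2 ^ 30 ≤ n ^ 30 := Nat.pow_le_pow_left hn 30
  have hpow' : 2 ^ 15 ≤ n ^ 15 := Nat.pow_le_pow_left hn 15
  rcases pow_thirty_div_cases n with h | h | h
  · have := (Nat.prime_dvd_prime_iff_eq Nat.prime_two hp).1 h
    omega
  · have := (Nat.prime_dvd_prime_iff_eq Nat.prime_three hp).1 h
    omega
  · have hsq : (n ^ 15) ^ 2 = 1116 * (n ^ 30 / 1116) + 30 ^ 2 := by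
      rw [← pow_mul, show 15 * 2 = 30 from rfl]
      omega
    have := le_add_of_sq_eq_mul_prime_add_sq hp (by norm_num) hsq
    omega
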